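/- Let M ∈ ℝ_{≥0}^{I×J} be a nonnegative matrix with a rank-r semidefinite factorization (U_i)_{i∈I}, (V^j)_{j∈J} such that the averages Ū = (1/|I|) Σ_{i∈I} U_i and V̄ = (1/|J|) Σ_{j∈J} V^j are nonsingular. Define Φ(A) = (max_{i∈I} ‖A U_i A‖) · (max_{j∈J} ‖A⁻¹ V^j A⁻¹‖) for nonsingular A ∈ S₊^r. Then the infimum of Φ over all nonsingular r×r PSD matrices A is attained, i.e., there exists a nonsingular A* ∈ S₊^r with Φ(A*) = inf{Φ(A) : A ∈ S₊^r nonsingular}. -/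

import Mathlib

open Matrix Filter Topology

/-- Operator norm (ℓ² → ℓ²) of a square real matrix. -/
noncomputable def opNorm {r : ℕ} (M : Matrix (Fin r) (Fin r) ℝ) : ℝ :=
  ‖LinearMap.toContinuousLinearMap (Matrix.toEuclideanLin M)‖

section ConjSup

open scoped Matrix.Norms.L2Operator

variable {ι κ : Type*} {r : ℕ}

/-- The largest operator norm `‖A * W i * A‖` over a family of matrices `W`. -/
noncomputable def conjSup (W : ι → Matrix (Fin r) (Fin r) ℝ) (A : Matrix (Fin r) (Fin r) ℝ) : ℝ :=
  ⨆ i, opNorm (A * W i * A)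

lemma conjSup_eq (W : ι → Matrix (Fin r) (Fin r) ℝ) (A : Matrix (Fin r) (Fin r) ℝ) :
    conjSup W A = ⨆ i, ‖A * W i * A‖ := rfl

lemma conjSup_nonneg (W : ι → Matrix (Fin r) (Fin r) ℝ) (A : Matrix (Fin r) (Fin r) ℝ) :
    0 ≤ conjSup W A :=
  Real.iSup_nonneg fun _ => norm_nonneg _

lemma norm_le_conjSup [Fintype ι] (W : ι → Matrix (Fin r) (Fin r) ℝ) (A : Matrix (Fin r) (Fin r) ℝ) (i : ι) :
    ‖A * W i * A‖ ≤ conjSup W A :=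
  le_ciSup (f := fun i => ‖A * W i * A‖) (Set.finite_range _).bddAbove i

lemma conjSup_smul (W : ι → Matrix (Fin r) (Fin r) ℝ) (c : ℝ) (A : Matrix (Fin r) (Fin r) ℝ) :
    conjSup W (c • A) = c ^ 2 * conjSup W A := by
  rw [conjSup_eq, conjSup_eq, Real.mul_iSup_of_nonneg (sq_nonneg c)]
  refine iSup_congr fun i => ?_
  rw [smul_mul_assoc, smul_mul_assoc, mul_smul_comm, norm_smul, norm_smul, ← mul_assoc,
    Real.norm_eq_abs, abs_mul_abs_self, sq]

lemma continuous_conjSup [Fintype ι] [Nonempty ι] (W : ι → Matrix (Fin r) (Fin r) ℝ) : Continuous (conjSup W) := by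
  have h : conjSup W = fun A => Finset.univ.sup' Finset.univ_nonempty fun i => ‖A * W i * A‖ := by
    ext A
    rw [conjSup_eq, Finset.sup'_univ_eq_ciSup]
  rw [h]
  exact Continuous.finset_sup'_apply _ fun i _ =>
    ((continuous_id.mul continuous_const).mul continuous_id).norm

open scoped MatrixOrder in
lemma exists_mul_norm_sq_le_conjSup [Fintype ι] [Nonempty ι] {W : ι → Matrix (Fin r) (Fin r) ℝ}
    (hW : ∀ i, (W i).PosSemidef) (hunit : IsUnit ((Fintype.card ι : ℝ)⁻¹ • ∑ i, W i)) :
    ∃ c > 0, ∀ A : Matrix (Fin r) (Fin r) ℝ, A.IsHermitian → c * ‖A‖ ^ 2 ≤ conjSup W A := by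
  have hpsd : ((Fintype.card ι : ℝ)⁻¹ • ∑ i, W i).PosSemidef :=
    (Matrix.posSemidef_sum _ fun i _ => hW i).smul (by positivity)
  obtain ⟨B, hB⟩ : ∃ B : Matrix (Fin r) (Fin r) ℝ, (Fintype.card ι : ℝ)⁻¹ • ∑ i, W i = Bᴴ * B :=
    CStarAlgebra.nonneg_iff_eq_star_mul_self.mp hpsd.nonneg
  have hBunit : IsUnit B := by
    rw [hB] at hunit
    rw [Matrix.isUnit_iff_isUnit_det] at hunit ⊢
    rw [Matrix.det_mul] at hunit
    exact isUnit_of_mul_isUnit_right hunit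
  have hBB : B⁻¹ * B = 1 := Matrix.nonsing_inv_mul B ((Matrix.isUnit_iff_isUnit_det B).mp hBunit)
  refine ⟨((‖B⁻¹‖ + 1) ^ 2)⁻¹, by positivity, fun A hA => ?_⟩
  have hnorm : ‖A‖ ≤ (‖B⁻¹‖ + 1) * ‖B * A‖ := by
    calc ‖A‖ = ‖B⁻¹ * (B * A)‖ := by rw [← mul_assoc, hBB, one_mul]
      _ ≤ ‖B⁻¹‖ * ‖B * A‖ := norm_mul_le _ _
      _ ≤ _ := by gcongr; linarith
  have havg : ‖B * A‖ ^ 2 ≤ conjSup W A := by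
    have hcard : (0 : ℝ) < Fintype.card ι := by exact_mod_cast Fintype.card_pos
    calc ‖B * A‖ ^ 2 = ‖(B * A)ᴴ * (B * A)‖ := by
          rw [Matrix.l2_opNorm_conjTranspose_mul_self, sq]
      _ = ‖(Fintype.card ι : ℝ)⁻¹ • ∑ i, A * W i * A‖ := by
          rw [Matrix.conjTranspose_mul, hA.eq, mul_assoc, ← mul_assoc Bᴴ, ← hB, smul_mul_assoc,
            mul_smul_comm, Finset.sum_mul, Finset.mul_sum]
          simp only [mul_assoc]
      _ ≤ (Fintype.card ι : ℝ)⁻¹ * ∑ i, ‖A * W i * A‖ := by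
          rw [norm_smul, Real.norm_of_nonneg (by positivity)]
          gcongr
          exact norm_sum_le _ _
      _ ≤ (Fintype.card ι : ℝ)⁻¹ * ∑ _i : ι, conjSup W A := by
          gcongr with i
          exact norm_le_conjSup W A i
      _ = conjSup W A := by
          rw [Finset.sum_const, Finset.card_univ, nsmul_eq_mul, inv_mul_cancel_left₀ hcard.ne']
  rw [inv_mul_le_iff₀ (by positivity)]
  calc ‖A‖ ^ 2 ≤ ((‖B⁻¹‖ + 1) * ‖B * A‖) ^ 2 := by gcongr
    _ = (‖B⁻¹‖ + 1) ^ 2 * ‖B * A‖ ^ 2 := mul_pow _ _ _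
    _ ≤ _ := by gcongr

lemma isClosed_setOf_posSemidef :
    IsClosed {A : Matrix (Fin r) (Fin r) ℝ | A.PosSemidef} := by
  simp only [Matrix.posSemidef_iff_dotProduct_mulVec, Set.ofPred_and, Set.ofPred_forall]
  refine IsClosed.inter (isClosed_eq (Continuous.matrix_conjTranspose continuous_id) continuous_id)
    (isClosed_iInter fun x => isClosed_le continuous_const ?_)
  fun_prop

lemma conjSup_mul_conjSup_inv_smul (U : ι → Matrix (Fin r) (Fin r) ℝ)
    (V : κ → Matrix (Fin r) (Fin r) ℝ) {c : ℝ} (hc : c ≠ 0) {A : Matrix (Fin r) (Fin r) ℝ}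
    (hA : IsUnit A) :
    conjSup U (c • A) * conjSup V (c • A)⁻¹ = conjSup U A * conjSup V A⁻¹ := by
  have hinv : (c • A)⁻¹ = c⁻¹ • A⁻¹ := by
    refine Matrix.inv_eq_right_inv ?_
    rw [smul_mul_smul_comm, mul_inv_cancel₀ hc, one_smul,
      Matrix.mul_nonsing_inv A ((Matrix.isUnit_iff_isUnit_det A).mp hA)]
  rw [hinv, conjSup_smul, conjSup_smul]
  field_simp

lemma exists_forall_conjSup_mul_conjSup_inv_le [Fintype ι] [Nonempty ι] [Fintype κ] [Nonempty κ]
    {U : ι → Matrix (Fin r) (Fin r) ℝ}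
    {V : κ → Matrix (Fin r) (Fin r) ℝ}
    (hU : ∀ i, (U i).PosSemidef) (hV : ∀ j, (V j).PosSemidef)
    (hUunit : IsUnit ((Fintype.card ι : ℝ)⁻¹ • ∑ i, U i))
    (hVunit : IsUnit ((Fintype.card κ : ℝ)⁻¹ • ∑ j, V j)) :
    ∃ A₀ : Matrix (Fin r) (Fin r) ℝ, A₀.PosSemidef ∧ IsUnit A₀ ∧
      ∀ A : Matrix (Fin r) (Fin r) ℝ, A.PosSemidef → IsUnit A →
        conjSup U A₀ * conjSup V A₀⁻¹ ≤ conjSup U A * conjSup V A⁻¹ := by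
  rcases subsingleton_or_nontrivial (Matrix (Fin r) (Fin r) ℝ) with hsub | hnt
  · exact ⟨1, Matrix.PosSemidef.one, isUnit_one, fun A _ _ => by rw [Subsingleton.elim A 1]⟩
  obtain ⟨c, hc, hcU⟩ := exists_mul_norm_sq_le_conjSup hU hUunit
  obtain ⟨d, hd, hdV⟩ := exists_mul_norm_sq_le_conjSup hV hVunit
  set Φ₁ : ℝ := conjSup U 1 * conjSup V 1⁻¹ with hΦ₁
  set R : ℝ := max 1 (Φ₁ / (c * d))
  let K : Set (Matrix (Fin r) (Fin r) ℝ × Matrix (Fin r) (Fin r) ℝ) :=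
    {p | (p.1.PosSemidef ∧ p.1 * p.2 = 1) ∧ ‖p.1‖ = 1 ∧ ‖p.2‖ ≤ R}
  have : ProperSpace (Matrix (Fin r) (Fin r) ℝ) := FiniteDimensional.proper ℝ _
  have hK : IsCompact K := by
    refine Metric.isCompact_of_isClosed_isBounded ?_ ?_
    · exact ((isClosed_setOf_posSemidef.preimage continuous_fst).inter
        (isClosed_eq (continuous_fst.mul continuous_snd) continuous_const)).inter
        ((isClosed_eq continuous_fst.norm continuous_const).inter
          (isClosed_le continuous_snd.norm continuous_const))
    · refine isBounded_iff_forall_norm_le.mpr ⟨R, fun p hp => ?_⟩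
      rw [Prod.norm_def]
      exact max_le (hp.2.1.le.trans (le_max_left _ _)) hp.2.2
  have h1K : ((1, 1) : Matrix (Fin r) (Fin r) ℝ × Matrix (Fin r) (Fin r) ℝ) ∈ K :=
    ⟨⟨Matrix.PosSemidef.one, mul_one 1⟩, norm_one, norm_one.le.trans (le_max_left _ _)⟩
  obtain ⟨⟨A₀, B₀⟩, hAB, hisMin⟩ := hK.exists_isMinOn ⟨_, h1K⟩
    (((continuous_conjSup U).comp continuous_fst).mul
      ((continuous_conjSup V).comp continuous_snd)).continuousOn
  have hmin : ∀ A B : Matrix (Fin r) (Fin r) ℝ, (A, B) ∈ K →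
      conjSup U A₀ * conjSup V B₀ ≤ conjSup U A * conjSup V B := fun A B h =>
    isMinOn_iff.mp hisMin (A, B) h
  have hB₀ : A₀⁻¹ = B₀ := Matrix.inv_eq_right_inv hAB.1.2
  refine ⟨A₀, hAB.1.1, IsUnit.of_mul_eq_one _ hAB.1.2, fun A hA hAunit => ?_⟩
  have hA0 : 0 < ‖A‖ := norm_pos_iff.mpr hAunit.ne_zero
  have hscale : 0 < ‖A‖⁻¹ := inv_pos.mpr hA0
  rw [hB₀, ← conjSup_mul_conjSup_inv_smul U V hscale.ne' hAunit]
  set A' := ‖A‖⁻¹ • A with hA'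
  have hpsd : A'.PosSemidef := hA.smul hscale.le
  have hunit : IsUnit A' := hAunit.smul (Units.mk0 _ hscale.ne')
  have hnorm : ‖A'‖ = 1 := by
    rw [hA', norm_smul, Real.norm_of_nonneg hscale.le, inv_mul_cancel₀ hA0.ne']
  rcases le_or_gt ‖A'⁻¹‖ R with hle | hlt
  · have hmem : (A', A'⁻¹) ∈ K :=
      ⟨⟨hpsd, Matrix.mul_nonsing_inv A' ((Matrix.isUnit_iff_isUnit_det A').mp hunit)⟩, hnorm, hle⟩
    exact hmin _ _ hmem
  · calc conjSup U A₀ * conjSup V B₀ ≤ conjSup U 1 * conjSup V 1 := hmin _ _ h1K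
      _ = Φ₁ := by rw [hΦ₁, inv_one]
      _ ≤ (c * d) * R := by
          rw [← div_le_iff₀' (mul_pos hc hd)]
          exact le_max_right _ _
      _ ≤ (c * d) * ‖A'⁻¹‖ ^ 2 := by
          gcongr
          nlinarith [le_max_left 1 (Φ₁ / (c * d))]
      _ = (c * ‖A'‖ ^ 2) * (d * ‖A'⁻¹‖ ^ 2) := by rw [hnorm]; ring
      _ ≤ conjSup U A' * conjSup V A'⁻¹ :=
          mul_le_mul (hcU _ hpsd.isHermitian) (hdV _ hpsd.inv.isHermitian) (by positivity)
            (conjSup_nonneg _ _)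

end ConjSup

/-- The infimum of the potential
`Φ(A) = (max_i ‖A U_i A‖)·(max_j ‖A⁻¹ V^j A⁻¹‖)` over nonsingular PSD matrices
`A` is attained, provided the averages `Ū`, `V̄` of the factorization are
nonsingular. -/
theorem potential_inf_attained
    {ι κ : Type*} [Fintype ι] [Nonempty ι] [Fintype κ] [Nonempty κ]
    {r : ℕ} (M : ι → κ → ℝ) (hM : ∀ i j, 0 ≤ M i j)
    (U : ι → Matrix (Fin r) (Fin r) ℝ) (V : κ → Matrix (Fin r) (Fin r) ℝ)
    (hU : ∀ i, (U i).PosSemidef) (hV : ∀ j, (V j).PosSemidef)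
    (hfact : ∀ i j, (U i * V j).trace = M i j)
    (hUbarNS : IsUnit ((Fintype.card ι : ℝ)⁻¹ • ∑ i, U i))
    (hVbarNS : IsUnit ((Fintype.card κ : ℝ)⁻¹ • ∑ j, V j)) :
    ∃ Astar : Matrix (Fin r) (Fin r) ℝ, Astar.PosSemidef ∧ IsUnit Astar ∧
      (⨆ i, opNorm (Astar * U i * Astar)) * (⨆ j, opNorm (Astar⁻¹ * V j * Astar⁻¹)) =
        sInf {y : ℝ | ∃ A : Matrix (Fin r) (Fin r) ℝ, A.PosSemidef ∧ IsUnit A ∧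
          y = (⨆ i, opNorm (A * U i * A)) * (⨆ j, opNorm (A⁻¹ * V j * A⁻¹))} := by
  obtain ⟨A₀, hpsd, hunit, hmin⟩ :=
    exists_forall_conjSup_mul_conjSup_inv_le hU hV hUbarNS hVbarNS
  refine ⟨A₀, hpsd, hunit, Eq.symm (IsLeast.csInf_eq ⟨⟨A₀, hpsd, hunit, rfl⟩, ?_⟩)⟩
  rintro y ⟨A, hA, hAunit, rfl⟩
  exact hmin A hA hAunit
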